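/- For every integer m ≥ 1 there exist two polynomial maps f₁, f₂ : ℝ^{2m} → ℝ^{2m} sharing the common fixed point 0 which is locally asymptotically stable (LAS) for both maps and such that 0 is a repeller for the composition f₂ ∘ f₁; and there also exist two polynomial maps g₁, g₂ : ℝ^{2m} → ℝ^{2m} sharing the common fixed point 0 which is a repeller for both maps and such that 0 is LAS for the composition g₂ ∘ g₁. -/

import Mathlib

open Filter Topology

/-- `p` is a locally asymptotically stable (LAS) fixed point of `f : ℝⁿ → ℝⁿ`. -/
def IsLAS {n : ℕ} (f : EuclideanSpace ℝ (Fin n) → EuclideanSpace ℝ (Fin n))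
    (p : EuclideanSpace ℝ (Fin n)) : Prop :=
  (∀ ε > 0, ∃ δ > 0, ∀ x, ‖x - p‖ < δ → ∀ k : ℕ, 1 ≤ k → ‖f^[k] x - p‖ < ε) ∧
  (∃ η > 0, ∀ x, ‖x - p‖ < η → Tendsto (fun k => f^[k] x) atTop (𝓝 p))

/-- `p` is a repeller fixed point of `f : ℝⁿ → ℝⁿ`. -/
def IsRepeller {n : ℕ} (f : EuclideanSpace ℝ (Fin n) → EuclideanSpace ℝ (Fin n))
    (p : EuclideanSpace ℝ (Fin n)) : Prop :=
  ∃ ε₀ > 0, ∀ ε : ℝ, 0 < ε → ε < ε₀ → ∀ x, x ≠ p → ‖x - p‖ < ε →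
    ∃ k : ℕ, ‖f^[k] x - p‖ > ε

/-- `f : ℝⁿ → ℝⁿ` is a polynomial map: each component is given by a polynomial
in the `n` coordinates. -/
def IsPolyMap {n : ℕ} (f : EuclideanSpace ℝ (Fin n) → EuclideanSpace ℝ (Fin n)) : Prop :=
  ∃ P : Fin n → MvPolynomial (Fin n) ℝ,
    ∀ x i, f x i = MvPolynomial.eval (fun j => x j) (P i)

section Lyapunov

variable {n : ℕ} {f : EuclideanSpace ℝ (Fin n) → EuclideanSpace ℝ (Fin n)}
  {V : EuclideanSpace ℝ (Fin n) → ℝ}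

/-- If `V` converges along a bounded orbit of `f`, then some point of the limit set has the limit
value of `V`, and so does its image under `f`. -/
theorem exists_limit_point_of_tendsto (hf : Continuous f) (hV : Continuous V)
    {x : EuclideanSpace ℝ (Fin n)} {r L : ℝ} (hr : ∀ k, ‖f^[k] x‖ ≤ r)
    (hL : Tendsto (fun k => V (f^[k] x)) atTop (𝓝 L)) :
    ∃ y, ‖y‖ ≤ r ∧ V y = L ∧ V (f y) = L := by
  obtain ⟨y, hy, φ, hφ, hlim⟩ :=
    (isCompact_closedBall (0 : EuclideanSpace ℝ (Fin n)) r).tendsto_subseq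
      (x := fun k => f^[k] x) (fun k => by simpa using hr k)
  refine ⟨y, by simpa using hy, ?_, ?_⟩
  · exact tendsto_nhds_unique ((hV.tendsto y).comp hlim) (hL.comp hφ.tendsto_atTop)
  · refine tendsto_nhds_unique (((hV.comp hf).tendsto y).comp hlim) ?_
    have h := hL.comp ((tendsto_add_atTop_nat 1).comp hφ.tendsto_atTop)
    simpa only [Function.comp_def, Function.iterate_succ_apply'] using h

/-- A strict Lyapunov function gives local asymptotic stability. -/
theorem isLAS_of_lyapunov (hf : Continuous f) (hf0 : f 0 = 0) (hV : Continuous V) (hV0 : V 0 = 0)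
    {c ρ : ℝ} (hc : 0 < c) (hcV : ∀ x, c * ‖x‖ ^ 2 ≤ V x) (hρ : 0 < ρ)
    (hdec : ∀ x, x ≠ 0 → ‖x‖ < ρ → V (f x) < V x) : IsLAS f 0 := by
  have hle : ∀ x, ‖x‖ < ρ → V (f x) ≤ V x := by
    intro x hx
    rcases eq_or_ne x 0 with rfl | h
    · rw [hf0]
    · exact (hdec x h hx).le
  have stable : ∀ ε > 0, ε ≤ ρ → ∃ δ > 0, ∀ x, ‖x‖ < δ → ∀ k : ℕ, ‖f^[k] x‖ < ε := by
    intro ε hε hερ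
    have hnorm : ∀ x, V x < c * ε ^ 2 → ‖x‖ < ε := by
      intro x hx
      have h := lt_of_mul_lt_mul_left ((hcV x).trans_lt hx) hc.le
      exact lt_of_pow_lt_pow_left₀ 2 hε.le h
    have hnear : ∀ᶠ x in 𝓝 (0 : EuclideanSpace ℝ (Fin n)), V x < c * ε ^ 2 :=
      hV.continuousAt.eventually_lt continuousAt_const (by rw [hV0]; positivity)
    obtain ⟨δ, hδ, hball⟩ := Metric.eventually_nhds_iff.1 hnear
    refine ⟨δ, hδ, fun x hx k => hnorm _ ?_⟩
    induction k with
    | zero => exact hball (by simpa using hx)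
    | succ k ih =>
      rw [Function.iterate_succ_apply']
      exact (hle _ ((hnorm _ ih).trans_le hερ)).trans_lt ih
  refine ⟨fun ε hε => ?_, ?_⟩
  · obtain ⟨δ, hδ, h⟩ := stable (min ε ρ) (lt_min hε hρ) (min_le_right _ _)
    refine ⟨δ, hδ, fun x hx k _ => ?_⟩
    rw [sub_zero] at hx ⊢
    exact (h x hx k).trans_le (min_le_left _ _)
  · obtain ⟨η, hη, h⟩ := stable (ρ / 2) (by positivity) (by linarith)
    refine ⟨η, hη, fun x hx => ?_⟩
    rw [sub_zero] at hx
    have hb : ∀ k, ‖f^[k] x‖ ≤ ρ / 2 := fun k => (h x hx k).le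
    have hanti : Antitone fun k => V (f^[k] x) := antitone_nat_of_succ_le fun k => by
      rw [Function.iterate_succ_apply']
      exact hle _ ((h x hx k).trans (by linarith))
    have hbdd : BddBelow (Set.range fun k => V (f^[k] x)) := by
      refine ⟨0, ?_⟩
      rintro _ ⟨k, rfl⟩
      exact le_trans (by positivity) (hcV _)
    have hlim := tendsto_atTop_ciInf hanti hbdd
    obtain ⟨y, hy, hVy, hVfy⟩ := exists_limit_point_of_tendsto hf hV hb hlim
    have hy0 : y = 0 := by
      by_contra hne
      exact absurd (hVfy.trans hVy.symm) (hdec y hne (by linarith)).ne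
    rw [← hVy, hy0, hV0] at hlim
    have hsq : Tendsto (fun k => ‖f^[k] x‖ ^ 2) atTop (𝓝 0) := by
      refine squeeze_zero (fun k => by positivity) (fun k => ?_)
        (by simpa using hlim.const_mul c⁻¹)
      rw [inv_mul_eq_div, le_div_iff₀ hc, mul_comm]
      exact hcV _
    refine tendsto_zero_iff_norm_tendsto_zero.2 ?_
    simpa using hsq.sqrt

/-- A function increasing strictly along orbits near `0` makes `0` a repeller. -/
theorem isRepeller_of_lyapunov (hf : Continuous f) (hV : Continuous V) (hV0 : V 0 = 0)
    (hVpos : ∀ x, 0 ≤ V x) {ρ : ℝ} (hρ : 0 < ρ)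
    (hinc : ∀ x, x ≠ 0 → ‖x‖ < ρ → V x < V (f x)) : IsRepeller f 0 := by
  refine ⟨ρ, hρ, fun ε hε hερ x hx hxε => ?_⟩
  simp only [sub_zero] at hxε ⊢
  by_contra! hb
  have hle : ∀ y, ‖y‖ ≤ ε → V y ≤ V (f y) := by
    intro y hy
    rcases eq_or_ne y 0 with rfl | h
    · rw [hV0]
      exact hVpos _
    · exact (hinc y h (hy.trans_lt hερ)).le
  have hmono : Monotone fun k => V (f^[k] x) := monotone_nat_of_le_succ fun k => by
    rw [Function.iterate_succ_apply']
    exact hle _ (hb k)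
  have hbdd : BddAbove (Set.range fun k => V (f^[k] x)) := by
    refine ((isCompact_closedBall (0 : EuclideanSpace ℝ (Fin n)) ε).image hV).bddAbove.mono ?_
    rintro _ ⟨k, rfl⟩
    exact ⟨_, by simpa using hb k, rfl⟩
  have hlim := tendsto_atTop_ciSup hmono hbdd
  obtain ⟨y, hy, hVy, hVfy⟩ := exists_limit_point_of_tendsto hf hV hb hlim
  have hne : y ≠ 0 := by
    rintro rfl
    have h1 : V (f^[1] x) ≤ V 0 := hVy ▸ hmono.ge_of_tendsto hlim 1
    have h2 : V x < V (f x) := hinc x hx (hxε.trans hερ)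
    rw [Function.iterate_one, hV0] at h1
    linarith [hVpos x]
  exact absurd (hVfy.trans hVy.symm) (hinc y hne (hy.trans_lt hερ)).ne'

theorem IsRepeller.of_iterate {j : ℕ} (h : IsRepeller (f^[j]) 0) : IsRepeller f 0 := by
  obtain ⟨ρ, hρ, h⟩ := h
  refine ⟨ρ, hρ, fun ε hε hερ x hx hxε => ?_⟩
  obtain ⟨k, hk⟩ := h ε hε hερ x hx hxε
  exact ⟨j * k, by rwa [Function.iterate_mul]⟩

theorem IsLAS.of_iterate_two (hf : Continuous f) (hf0 : f 0 = 0) (h : IsLAS (f^[2]) 0) :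
    IsLAS f 0 := by
  obtain ⟨hs, η, hη, ht⟩ := h
  refine ⟨fun ε hε => ?_, η, hη, fun x hx => ?_⟩
  · obtain ⟨ε', hε', hfε⟩ := Metric.continuousAt_iff.1 (hf.continuousAt (x := 0)) ε hε
    simp only [dist_zero_right, hf0] at hfε
    obtain ⟨δ, hδ, hk⟩ := hs (min ε ε') (lt_min hε hε')
    simp only [sub_zero, lt_min_iff] at hk ⊢
    have hδ' : 0 < min δ (min ε ε') := lt_min hδ (lt_min hε hε')
    refine ⟨_, hδ', fun x hx k _ => ?_⟩
    simp only [lt_min_iff] at hx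
    have hall : ∀ l, ‖f^[2 * l] x‖ < ε ∧ ‖f^[2 * l] x‖ < ε' := by
      intro l
      rcases Nat.eq_zero_or_pos l with rfl | hl
      · exact hx.2
      · rw [Function.iterate_mul]
        exact hk x hx.1 l hl
    obtain ⟨l, rfl | rfl⟩ := Nat.even_or_odd' k
    · exact (hall l).1
    · rw [Function.iterate_succ_apply']
      exact hfε (hall l).2
  · have heven := ht x hx
    have hodd := (hf.tendsto 0).comp heven
    rw [hf0] at hodd
    simp only [← Function.iterate_mul, Function.comp_def] at heven hodd
    rw [Metric.tendsto_atTop] at heven hodd ⊢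
    intro ε hε
    obtain ⟨N, hN⟩ := heven ε hε
    obtain ⟨M, hM⟩ := hodd ε hε
    refine ⟨2 * (N + M) + 1, fun k hk => ?_⟩
    obtain ⟨l, rfl | rfl⟩ := Nat.even_or_odd' k
    · exact hN l (by omega)
    · rw [Function.iterate_succ_apply']
      exact hM l (by omega)

end Lyapunov

section Blocks

variable {m : ℕ}

/-- The `i`-th planar block of coordinates of a vector of `ℝ^{2m}`. -/
def block (x : EuclideanSpace ℝ (Fin (2 * m))) (i : Fin m) : Fin 2 → ℝ :=
  fun a => x (finProdFinEquiv (a, i))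

/-- The map of `ℝ^{2m}` acting as `φ` on each planar block. -/
def blockMap (m : ℕ) (φ : (Fin 2 → ℝ) → Fin 2 → ℝ) (x : EuclideanSpace ℝ (Fin (2 * m))) :
    EuclideanSpace ℝ (Fin (2 * m)) :=
  WithLp.toLp 2 fun j => φ (block x (finProdFinEquiv.symm j).2) (finProdFinEquiv.symm j).1

@[simp]
theorem block_blockMap (φ : (Fin 2 → ℝ) → Fin 2 → ℝ) (x : EuclideanSpace ℝ (Fin (2 * m)))
    (i : Fin m) : block (blockMap m φ x) i = φ (block x i) := by
  ext a
  simp only [block, blockMap, Equiv.symm_apply_apply]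

@[simp]
theorem block_zero (i : Fin m) : block (0 : EuclideanSpace ℝ (Fin (2 * m))) i = 0 := rfl

theorem block_injective : Function.Injective (block (m := m)) := by
  intro x y h
  ext j
  have := congrFun (congrFun h (finProdFinEquiv.symm j).2) (finProdFinEquiv.symm j).1
  simpa only [block, Prod.mk.eta, Equiv.apply_symm_apply] using this

theorem blockMap_comp (φ ψ : (Fin 2 → ℝ) → Fin 2 → ℝ) :
    blockMap m φ ∘ blockMap m ψ = blockMap m (φ ∘ ψ) := by
  funext x
  apply block_injective
  funext i
  simp

theorem blockMap_zero {φ : (Fin 2 → ℝ) → Fin 2 → ℝ} (h : φ 0 = 0) : blockMap m φ 0 = 0 := by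
  apply block_injective
  funext i
  simp [h]

theorem continuous_block (i : Fin m) : Continuous fun x => block x i := by
  unfold block
  fun_prop

theorem continuous_blockMap {φ : (Fin 2 → ℝ) → Fin 2 → ℝ} (h : Continuous φ) :
    Continuous (blockMap m φ) := by
  refine (PiLp.continuous_toLp 2 _).comp (continuous_pi fun j => ?_)
  exact (continuous_apply _).comp (h.comp (continuous_block _))

theorem isPolyMap_blockMap {φ : (Fin 2 → ℝ) → Fin 2 → ℝ} (P : Fin 2 → MvPolynomial (Fin 2) ℝ)
    (h : ∀ v a, φ v a = MvPolynomial.eval v (P a)) : IsPolyMap (blockMap m φ) := by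
  refine ⟨fun j => MvPolynomial.rename (fun a => finProdFinEquiv (a, (finProdFinEquiv.symm j).2))
    (P (finProdFinEquiv.symm j).1), fun x j => ?_⟩
  rw [MvPolynomial.eval_rename]
  exact h _ _

/-- The quadratic form `v₀² + k v₁²` on the plane. -/
def planarForm (k : ℝ) (v : Fin 2 → ℝ) : ℝ := v 0 ^ 2 + k * v 1 ^ 2

/-- The sum of the quadratic forms `planarForm k` over all blocks. -/
def blockForm (k : ℝ) (x : EuclideanSpace ℝ (Fin (2 * m))) : ℝ := ∑ i, planarForm k (block x i)

theorem norm_sq_eq_blockForm (x : EuclideanSpace ℝ (Fin (2 * m))) : ‖x‖ ^ 2 = blockForm 1 x := by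
  rw [EuclideanSpace.real_norm_sq_eq, ← finProdFinEquiv.sum_comp, Fintype.sum_prod_type_right]
  simp [blockForm, planarForm, block]

theorem continuous_blockForm (k : ℝ) : Continuous (blockForm (m := m) k) := by
  unfold blockForm planarForm block
  fun_prop

theorem blockForm_zero (k : ℝ) : blockForm k (0 : EuclideanSpace ℝ (Fin (2 * m))) = 0 := by
  simp [blockForm, planarForm]

theorem mul_norm_sq_le_blockForm {k : ℝ} (hk : k ≤ 1) (x : EuclideanSpace ℝ (Fin (2 * m))) :
    k * ‖x‖ ^ 2 ≤ blockForm k x := by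
  rw [norm_sq_eq_blockForm, blockForm, blockForm, Finset.mul_sum]
  refine Finset.sum_le_sum fun i _ => ?_
  simp only [planarForm]
  nlinarith [sq_nonneg (block x i 0)]

theorem planarForm_block_le (x : EuclideanSpace ℝ (Fin (2 * m))) (i : Fin m) :
    planarForm 1 (block x i) ≤ ‖x‖ ^ 2 := by
  rw [norm_sq_eq_blockForm]
  refine Finset.single_le_sum (f := fun i => planarForm 1 (block x i)) (fun i _ => ?_)
    (Finset.mem_univ i)
  simp only [planarForm]
  positivity

/-- Strict inequalities between planar forms pass to sums over blocks. -/
theorem sum_block_lt_sum_block {F G : (Fin 2 → ℝ) → ℝ} {ρ : ℝ} (h0 : F 0 = G 0)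
    (h : ∀ v, v ≠ 0 → planarForm 1 v < ρ ^ 2 → F v < G v)
    {x : EuclideanSpace ℝ (Fin (2 * m))} (hx : x ≠ 0) (hxρ : ‖x‖ < ρ) :
    ∑ i, F (block x i) < ∑ i, G (block x i) := by
  have hsmall : ∀ i, planarForm 1 (block x i) < ρ ^ 2 := fun i =>
    (planarForm_block_le x i).trans_lt (by gcongr)
  obtain ⟨i, hi⟩ : ∃ i, block x i ≠ 0 := by
    by_contra! hall
    exact hx (block_injective (funext hall))
  refine Finset.sum_lt_sum (fun j _ => ?_) ⟨i, Finset.mem_univ i, h _ hi (hsmall i)⟩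
  by_cases hj : block x j = 0
  · rw [hj, h0]
  · exact (h _ hj (hsmall j)).le

theorem isLAS_blockMap {φ : (Fin 2 → ℝ) → Fin 2 → ℝ} (hφ : Continuous φ) (hφ0 : φ 0 = 0)
    {k ρ : ℝ} (hk0 : 0 < k) (hk1 : k ≤ 1) (hρ : 0 < ρ)
    (h : ∀ v, v ≠ 0 → planarForm 1 v < ρ ^ 2 → planarForm k (φ v) < planarForm k v) :
    IsLAS (blockMap m φ) 0 := by
  refine isLAS_of_lyapunov (V := blockForm k) (continuous_blockMap hφ) (blockMap_zero hφ0)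
    (continuous_blockForm k) (blockForm_zero k) hk0 (mul_norm_sq_le_blockForm hk1) hρ
    fun x hx hxρ => ?_
  simp only [blockForm, block_blockMap]
  exact sum_block_lt_sum_block (F := fun v => planarForm k (φ v)) (by rw [hφ0]) h hx hxρ

theorem isRepeller_blockMap {φ : (Fin 2 → ℝ) → Fin 2 → ℝ} (hφ : Continuous φ) (hφ0 : φ 0 = 0)
    {k ρ : ℝ} (hk0 : 0 < k) (hk1 : k ≤ 1) (hρ : 0 < ρ)
    (h : ∀ v, v ≠ 0 → planarForm 1 v < ρ ^ 2 → planarForm k v < planarForm k (φ v)) :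
    IsRepeller (blockMap m φ) 0 := by
  refine isRepeller_of_lyapunov (V := blockForm k) (continuous_blockMap hφ)
    (continuous_blockForm k) (blockForm_zero k)
    (fun x => le_trans (by positivity) (mul_norm_sq_le_blockForm hk1 x)) hρ
    fun x hx hxρ => ?_
  simp only [blockForm, block_blockMap]
  exact sum_block_lt_sum_block (G := fun v => planarForm k (φ v)) (by rw [hφ0]) h hx hxρ

theorem iterate_blockMap (φ : (Fin 2 → ℝ) → Fin 2 → ℝ) (j : ℕ) :
    (blockMap m φ)^[j] = blockMap m φ^[j] := by
  funext x
  apply block_injective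
  funext i
  induction j generalizing x with
  | zero => simp
  | succ j ih => simp [ih]

end Blocks

section Planar

/-- A planar map preserving the ellipses `v₀² + v₁² / 2 = const` up to terms of degree five, and
moving along them at a non-uniform speed. -/
noncomputable def twist (σ : ℝ) (v : Fin 2 → ℝ) : Fin 2 → ℝ :=
  ![v 0 * (1 - σ * (v 0 ^ 2 + v 1 ^ 2) ^ 2 - σ * v 1 ^ 2 / 2),
    v 1 * (1 - σ * (v 0 ^ 2 + v 1 ^ 2) ^ 2 + σ * v 0 ^ 2)]

/-- The planar rotation of angle `π / 4`, with a radial correction of degree five. -/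
noncomputable def spiral (σ : ℝ) (v : Fin 2 → ℝ) : Fin 2 → ℝ :=
  ![√(1 / 2) * (1 - σ * (v 0 ^ 2 + v 1 ^ 2) ^ 2) * (v 0 - v 1),
    √(1 / 2) * (1 - σ * (v 0 ^ 2 + v 1 ^ 2) ^ 2) * (v 0 + v 1)]

theorem continuous_twist (σ : ℝ) : Continuous (twist σ) := by
  refine continuous_pi fun a => ?_
  fin_cases a <;> simp [twist] <;> fun_prop

theorem continuous_spiral (σ : ℝ) : Continuous (spiral σ) := by
  refine continuous_pi fun a => ?_
  fin_cases a <;> simp [spiral] <;> fun_prop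

theorem twist_zero (σ : ℝ) : twist σ 0 = 0 := by
  ext a
  fin_cases a <;> simp [twist]

theorem spiral_zero (σ : ℝ) : spiral σ 0 = 0 := by
  ext a
  fin_cases a <;> simp [spiral]

open MvPolynomial in
theorem isPolyMap_twist (m : ℕ) (σ : ℝ) : IsPolyMap (blockMap m (twist σ)) := by
  refine isPolyMap_blockMap
    ![X 0 * (1 - C σ * (X 0 ^ 2 + X 1 ^ 2) ^ 2 - C (σ / 2) * X 1 ^ 2),
      X 1 * (1 - C σ * (X 0 ^ 2 + X 1 ^ 2) ^ 2 + C σ * X 0 ^ 2)] fun v a => ?_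
  fin_cases a
  · simp [twist]
    exact Or.inl (by ring)
  · simp [twist]

open MvPolynomial in
theorem isPolyMap_spiral (m : ℕ) (σ : ℝ) : IsPolyMap (blockMap m (spiral σ)) := by
  refine isPolyMap_blockMap
    ![C √(1 / 2) * (1 - C σ * (X 0 ^ 2 + X 1 ^ 2) ^ 2) * (X 0 - X 1),
      C √(1 / 2) * (1 - C σ * (X 0 ^ 2 + X 1 ^ 2) ^ 2) * (X 0 + X 1)] fun v a => ?_
  fin_cases a <;> simp [spiral]

theorem planarForm_pos {k : ℝ} (hk : 0 < k) {v : Fin 2 → ℝ} (hv : v ≠ 0) :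
    0 < planarForm k v := by
  by_contra! h
  simp only [planarForm] at h
  have h0 : v 0 ^ 2 = 0 := by nlinarith [sq_nonneg (v 0), sq_nonneg (v 1)]
  have h1 : v 1 ^ 2 = 0 := by nlinarith [sq_nonneg (v 0), sq_nonneg (v 1)]
  apply hv
  ext a
  fin_cases a
  · simpa using h0
  · simpa using h1

theorem planarForm_twist {σ : ℝ} (hσ : σ ^ 2 = 1) (v : Fin 2 → ℝ) :
    planarForm (1 / 2) (twist σ v) = planarForm (1 / 2) v *
      ((1 - σ * planarForm 1 v ^ 2) ^ 2 + v 0 ^ 2 * v 1 ^ 2 / 2) := by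
  simp [planarForm, twist]
  linear_combination (v 0 ^ 2 * v 1 ^ 2 / 2 * (v 0 ^ 2 + v 1 ^ 2 / 2)) * hσ

theorem planarForm_spiral (σ : ℝ) (v : Fin 2 → ℝ) :
    planarForm 1 (spiral σ v) = planarForm 1 v * (1 - σ * planarForm 1 v ^ 2) ^ 2 := by
  have h : √(1 / 2 : ℝ) ^ 2 = 1 / 2 := Real.sq_sqrt (by norm_num)
  simp only [planarForm, spiral, Matrix.cons_val_zero, Matrix.cons_val_one]
  generalize √(1 / 2 : ℝ) = c at h
  linear_combination (2 * (v 0 ^ 2 + v 1 ^ 2) * (1 - σ * (v 0 ^ 2 + v 1 ^ 2) ^ 2) ^ 2) * h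

theorem mul_coord_spiral (σ : ℝ) (v : Fin 2 → ℝ) :
    spiral σ v 0 * spiral σ v 1 =
      (1 - σ * planarForm 1 v ^ 2) ^ 2 * (v 0 ^ 2 - v 1 ^ 2) / 2 := by
  have h : √(1 / 2 : ℝ) ^ 2 = 1 / 2 := Real.sq_sqrt (by norm_num)
  simp only [planarForm, spiral, Matrix.cons_val_zero, Matrix.cons_val_one]
  generalize √(1 / 2 : ℝ) = c at h
  linear_combination ((v 0 ^ 2 - v 1 ^ 2) * (1 - σ * (v 0 ^ 2 + v 1 ^ 2) ^ 2) ^ 2) * h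

theorem planarForm_twist_lt {v : Fin 2 → ℝ} (hv : v ≠ 0) (hs : planarForm 1 v < 1) :
    planarForm (1 / 2) (twist 1 v) < planarForm (1 / 2) v := by
  rw [planarForm_twist (by norm_num)]
  refine mul_lt_of_lt_one_right (planarForm_pos (by norm_num) hv) ?_
  have hn := planarForm_pos one_pos hv
  have hq : v 0 ^ 2 * v 1 ^ 2 ≤ planarForm 1 v ^ 2 / 4 := by
    simp only [planarForm]
    nlinarith [sq_nonneg (v 0 ^ 2 - v 1 ^ 2)]
  have hlt : planarForm 1 v ^ 2 < 1 := by nlinarith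
  have hpos : 0 < planarForm 1 v ^ 2 := by positivity
  nlinarith

theorem lt_planarForm_twist {v : Fin 2 → ℝ} (hv : v ≠ 0) :
    planarForm (1 / 2) v < planarForm (1 / 2) (twist (-1) v) := by
  rw [planarForm_twist (by norm_num)]
  refine lt_mul_of_one_lt_right (planarForm_pos (by norm_num) hv) ?_
  have hn := planarForm_pos one_pos hv
  have hpos : 0 < planarForm 1 v ^ 2 := by positivity
  have hq : 0 ≤ v 0 ^ 2 * v 1 ^ 2 := by positivity
  nlinarith

theorem planarForm_spiral_lt {v : Fin 2 → ℝ} (hv : v ≠ 0) (hs : planarForm 1 v < 1) :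
    planarForm 1 (spiral 1 v) < planarForm 1 v := by
  rw [planarForm_spiral]
  have hn := planarForm_pos one_pos hv
  refine mul_lt_of_lt_one_right hn ?_
  have hlt : planarForm 1 v ^ 2 < 1 := by nlinarith
  have hpos : 0 < planarForm 1 v ^ 2 := by positivity
  nlinarith

theorem lt_planarForm_spiral {v : Fin 2 → ℝ} (hv : v ≠ 0) :
    planarForm 1 v < planarForm 1 (spiral (-1) v) := by
  rw [planarForm_spiral]
  have hn := planarForm_pos one_pos hv
  refine lt_mul_of_one_lt_right hn ?_
  have hpos : 0 < planarForm 1 v ^ 2 := by positivity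
  nlinarith

theorem abs_mul_one_sub_sq_sub_self_le {σ t : ℝ} (hσ : |σ| = 1) (h0 : 0 ≤ t) (h1 : t ≤ 1) :
    |t * (1 - σ * t ^ 2) ^ 2 - t| ≤ 3 * t ^ 3 := by
  have hσ2 : σ ^ 2 = 1 := by rw [← sq_abs, hσ, one_pow]
  have hfac : t * (1 - σ * t ^ 2) ^ 2 - t = t ^ 3 * (t ^ 2 - 2 * σ) := by
    linear_combination t ^ 5 * hσ2
  have hbound : |t ^ 2 - 2 * σ| ≤ 3 := by
    rw [abs_le]
    constructor <;> nlinarith [abs_le.1 hσ.le]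
  rw [hfac, abs_mul, abs_of_nonneg (by positivity : 0 ≤ t ^ 3)]
  nlinarith [pow_nonneg h0 3]

theorem abs_planarForm_twist_sub_le {σ : ℝ} (hσ : |σ| = 1) {v : Fin 2 → ℝ}
    (hn : planarForm 1 v ≤ 1 / 2) :
    |planarForm 1 (twist σ v) - (planarForm 1 v + σ * (v 0 ^ 2 * v 1 ^ 2))| ≤
      4 * planarForm 1 v ^ 3 := by
  have hσ2 : σ ^ 2 = 1 := by rw [← sq_abs, hσ, one_pow]
  have hx := sq_nonneg (v 0)
  have hy := sq_nonneg (v 1)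
  simp only [planarForm, twist, Matrix.cons_val_zero, Matrix.cons_val_one, one_mul] at hn ⊢
  set x := v 0 ^ 2
  set y := v 1 ^ 2
  set n := x + y with hndef
  have h0 : 0 ≤ n := by positivity
  have hxy0 : 0 ≤ x * y := by positivity
  have hxy : x * y ≤ n ^ 2 / 4 := by nlinarith [sq_nonneg (x - y)]
  have hfac : (v 0 * (1 - σ * n ^ 2 - σ * y / 2)) ^ 2 + (v 1 * (1 - σ * n ^ 2 + σ * x)) ^ 2 -
      (n + σ * (x * y)) =
      (n * (1 - σ * n ^ 2) ^ 2 - n) + x * y * (x + y / 4 - n ^ 2) := by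
    linear_combination (x * y * (x + y / 4 - n ^ 2)) * hσ2
  have h3 := abs_mul_one_sub_sq_sub_self_le hσ h0 (by linarith)
  have h4 : |x * y * (x + y / 4 - n ^ 2)| ≤ n ^ 3 := by
    have : |x + y / 4 - n ^ 2| ≤ n := by
      rw [abs_le]
      constructor <;> nlinarith
    rw [abs_mul, abs_of_nonneg hxy0]
    calc x * y * |x + y / 4 - n ^ 2| ≤ n ^ 2 / 4 * n := by gcongr
      _ ≤ n ^ 3 := by nlinarith [pow_nonneg h0 3]
  rw [hfac]
  linarith [abs_add_le (n * (1 - σ * n ^ 2) ^ 2 - n) (x * y * (x + y / 4 - n ^ 2))]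

theorem abs_sq_sub_sq_twist_sub_le {σ : ℝ} (hσ : |σ| = 1) {v : Fin 2 → ℝ}
    (hn : planarForm 1 v ≤ 1 / 2) :
    |twist σ v 0 ^ 2 - twist σ v 1 ^ 2 - (v 0 ^ 2 - v 1 ^ 2)| ≤ 5 * planarForm 1 v ^ 2 := by
  have hx := sq_nonneg (v 0)
  have hy := sq_nonneg (v 1)
  simp only [planarForm, twist, Matrix.cons_val_zero, Matrix.cons_val_one, one_mul] at hn ⊢
  set x := v 0 ^ 2
  set y := v 1 ^ 2
  set n := x + y with hndef
  have h0 : 0 ≤ n := by positivity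
  have key : ∀ a, |a| ≤ 3 / 2 * n → |(1 + σ * a) ^ 2 - 1| ≤ 5 * n := by
    intro a ha
    have hb : |σ * a| ≤ 3 / 2 * n := by rwa [abs_mul, hσ, one_mul]
    rw [abs_le] at hb ⊢
    constructor <;> nlinarith
  have h1 := key (-n ^ 2 - y / 2) (by rw [abs_le]; constructor <;> nlinarith)
  have h2 := key (-n ^ 2 + x) (by rw [abs_le]; constructor <;> nlinarith)
  have hfac : (v 0 * (1 - σ * n ^ 2 - σ * y / 2)) ^ 2 - (v 1 * (1 - σ * n ^ 2 + σ * x)) ^ 2 -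
      (x - y) = x * ((1 + σ * (-n ^ 2 - y / 2)) ^ 2 - 1) - y * ((1 + σ * (-n ^ 2 + x)) ^ 2 - 1) := by
    ring
  rw [hfac]
  refine (abs_sub _ _).trans ?_
  rw [abs_mul, abs_mul, abs_of_nonneg hx, abs_of_nonneg hy]
  calc _ ≤ x * (5 * n) + y * (5 * n) := by gcongr
    _ = 5 * n ^ 2 := by rw [hndef]; ring

theorem planarForm_nonneg (v : Fin 2 → ℝ) : 0 ≤ planarForm 1 v := by
  simp only [planarForm]
  positivity

theorem sq_mul_sq_le (v : Fin 2 → ℝ) : v 0 ^ 2 * v 1 ^ 2 ≤ planarForm 1 v ^ 2 / 4 := by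
  simp only [planarForm]
  nlinarith [sq_nonneg (v 0 ^ 2 - v 1 ^ 2)]

theorem abs_sigma_mul_sq_mul_sq_le {σ : ℝ} (hσ : |σ| = 1) (v : Fin 2 → ℝ) :
    |σ * (v 0 ^ 2 * v 1 ^ 2)| ≤ planarForm 1 v ^ 2 / 4 := by
  rw [abs_mul, hσ, one_mul, abs_of_nonneg (by positivity)]
  exact sq_mul_sq_le v

theorem planarForm_twist_le {σ : ℝ} (hσ : |σ| = 1) {v : Fin 2 → ℝ}
    (hn : planarForm 1 v ≤ 1 / 10) : planarForm 1 (twist σ v) ≤ 2 * planarForm 1 v := by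
  have h0 := planarForm_nonneg v
  have h1 := (abs_le.1 (abs_planarForm_twist_sub_le hσ (hn.trans (by norm_num)))).2
  have h2 := (abs_le.1 (abs_sigma_mul_sq_mul_sq_le hσ v)).2
  nlinarith [mul_nonneg h0 h0, mul_nonneg (mul_nonneg h0 h0) (sub_nonneg.2 hn)]

/-- One step of the composition changes `v₀² + v₁²` by `± v₀² v₁²`, up to higher order terms. -/
theorem abs_planarForm_spiral_twist_sub_le {σ : ℝ} (hσ : |σ| = 1) {v : Fin 2 → ℝ}
    (hn : planarForm 1 v ≤ 1 / 10) :
    |planarForm 1 (spiral σ (twist σ v)) - (planarForm 1 v + σ * (v 0 ^ 2 * v 1 ^ 2))| ≤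
      28 * planarForm 1 v ^ 3 := by
  have hle := planarForm_twist_le hσ hn
  have h0 := planarForm_nonneg (twist σ v)
  have h1 := abs_planarForm_twist_sub_le hσ (hn.trans (by norm_num))
  have h2 := abs_mul_one_sub_sq_sub_self_le hσ h0 (by linarith)
  have h3 : planarForm 1 (twist σ v) ^ 3 ≤ (2 * planarForm 1 v) ^ 3 := by gcongr
  rw [planarForm_spiral]
  rw [abs_le] at *
  constructor <;> linarith

/-- One step of the composition turns `v₀² v₁²` into `(v₀² - v₁²)² / 4`, up to higher order
terms. -/
theorem abs_sq_mul_sq_spiral_twist_sub_le {σ : ℝ} (hσ : |σ| = 1) {v : Fin 2 → ℝ}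
    (hn : planarForm 1 v ≤ 1 / 10) :
    |spiral σ (twist σ v) 0 ^ 2 * spiral σ (twist σ v) 1 ^ 2 - (v 0 ^ 2 - v 1 ^ 2) ^ 2 / 4| ≤
      20 * planarForm 1 v ^ 3 := by
  have hle := planarForm_twist_le hσ hn
  have h0 := planarForm_nonneg (twist σ v)
  have hv0 := planarForm_nonneg v
  have h1 := abs_sq_sub_sq_twist_sub_le hσ (hn.trans (by norm_num))
  have hd : |v 0 ^ 2 - v 1 ^ 2| ≤ planarForm 1 v := by
    simp only [planarForm]
    rw [abs_le]
    constructor <;> nlinarith [sq_nonneg (v 0), sq_nonneg (v 1)]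
  have hD : |twist σ v 0 ^ 2 - twist σ v 1 ^ 2| ≤ planarForm 1 (twist σ v) := by
    simp only [planarForm]
    rw [abs_le]
    constructor <;> nlinarith [sq_nonneg (twist σ v 0), sq_nonneg (twist σ v 1)]
  rw [← mul_pow, mul_coord_spiral]
  set n := planarForm 1 v
  set r := planarForm 1 (twist σ v)
  set D := twist σ v 0 ^ 2 - twist σ v 1 ^ 2
  set d := v 0 ^ 2 - v 1 ^ 2
  have hDd : |D ^ 2 - d ^ 2| ≤ 5 * n ^ 2 * (3 * n) := by
    rw [show D ^ 2 - d ^ 2 = (D - d) * (D + d) by ring, abs_mul]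
    have : |D + d| ≤ 3 * n := (abs_add_le _ _).trans (by linarith)
    gcongr
  have hpow : |(1 - σ * r ^ 2) ^ 4 - 1| ≤ 15 * r ^ 2 := by
    have hb : |σ * r ^ 2| ≤ r ^ 2 := by rw [abs_mul, hσ, one_mul, abs_of_nonneg (by positivity)]
    have hr : r ^ 2 ≤ 1 := by nlinarith
    have hfac : (1 - σ * r ^ 2) ^ 4 - 1 =
        σ * r ^ 2 * (σ * r ^ 2 - 2) * (1 + (1 - σ * r ^ 2) ^ 2) := by ring
    generalize σ * r ^ 2 = t at hb hfac
    have ht := abs_le.1 hb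
    have h3 : |t - 2| ≤ 3 := abs_le.2 ⟨by linarith, by linarith⟩
    have h5 : |1 + (1 - t) ^ 2| ≤ 5 := by
      rw [abs_of_nonneg (by positivity)]
      nlinarith
    rw [hfac, abs_mul, abs_mul]
    calc |t| * |t - 2| * |1 + (1 - t) ^ 2| ≤ r ^ 2 * 3 * 5 := by gcongr
      _ = 15 * r ^ 2 := by ring
  have hD2 : D ^ 2 ≤ r ^ 2 := sq_le_sq' (abs_le.1 hD).1 (abs_le.1 hD).2
  have hprod : |((1 - σ * r ^ 2) ^ 4 - 1) * D ^ 2| ≤ 24 * n ^ 3 := by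
    rw [abs_mul, abs_of_nonneg (sq_nonneg D)]
    calc _ ≤ 15 * r ^ 2 * r ^ 2 := by gcongr
      _ = 15 * r ^ 4 := by ring
      _ ≤ 15 * (2 * n) ^ 4 := by gcongr
      _ = 240 * n ^ 3 * n := by ring
      _ ≤ 240 * n ^ 3 * (1 / 10) := by gcongr
      _ = 24 * n ^ 3 := by ring
  have hfin : ((1 - σ * r ^ 2) ^ 2 * D / 2) ^ 2 - d ^ 2 / 4 =
      (((1 - σ * r ^ 2) ^ 4 - 1) * D ^ 2 + (D ^ 2 - d ^ 2)) / 4 := by ring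
  have hn3 : 0 ≤ n ^ 3 := by positivity
  rw [hfin]
  rw [abs_le] at *
  constructor <;> linarith

/-- Two steps of the composition change `n = v₀² + v₁²` by `± n² / 4`, up to higher order terms. -/
theorem abs_planarForm_iterate_sub_le {σ : ℝ} (hσ : |σ| = 1) {v : Fin 2 → ℝ}
    (hn : planarForm 1 v ≤ 1 / 20) :
    |planarForm 1 ((spiral σ ∘ twist σ)^[2] v) - (planarForm 1 v + σ * (planarForm 1 v ^ 2 / 4))| ≤
      272 * planarForm 1 v ^ 3 := by
  have h0 := planarForm_nonneg v
  have h1 := abs_planarForm_spiral_twist_sub_le hσ (hn.trans (by norm_num))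
  have h2 := abs_sq_mul_sq_spiral_twist_sub_le hσ (hn.trans (by norm_num))
  have hq := (abs_le.1 (abs_sigma_mul_sq_mul_sq_le hσ v)).2
  have hle : planarForm 1 (spiral σ (twist σ v)) ≤ 2 * planarForm 1 v := by
    nlinarith [(abs_le.1 h1).2, mul_nonneg h0 h0, mul_nonneg (mul_nonneg h0 h0) (sub_nonneg.2 hn)]
  have hw0 := planarForm_nonneg (spiral σ (twist σ v))
  have h3 := abs_planarForm_spiral_twist_sub_le hσ (v := spiral σ (twist σ v)) (by linarith)
  have h4 : planarForm 1 (spiral σ (twist σ v)) ^ 3 ≤ (2 * planarForm 1 v) ^ 3 := by gcongr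
  have hid : planarForm 1 v ^ 2 / 4 = v 0 ^ 2 * v 1 ^ 2 + (v 0 ^ 2 - v 1 ^ 2) ^ 2 / 4 := by
    simp only [planarForm]
    ring
  simp only [Function.iterate_succ, Function.iterate_zero, Function.comp_apply, id_eq]
  rw [hid]
  have h5 := abs_mul σ (spiral σ (twist σ v) 0 ^ 2 * spiral σ (twist σ v) 1 ^ 2 -
    (v 0 ^ 2 - v 1 ^ 2) ^ 2 / 4)
  rw [hσ, one_mul, mul_sub] at h5
  rw [← h5] at h2
  clear h5
  rw [mul_add]
  rw [abs_le] at *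
  constructor <;> linarith

theorem lt_planarForm_iterate {v : Fin 2 → ℝ} (hv : v ≠ 0)
    (hn : planarForm 1 v < (1 / 100) ^ 2) :
    planarForm 1 v < planarForm 1 ((spiral 1 ∘ twist 1)^[2] v) := by
  have hpos := planarForm_pos one_pos hv
  have h := (abs_le.1 (abs_planarForm_iterate_sub_le (σ := 1) (v := v) (by simp) (by linarith))).1
  nlinarith [mul_pos hpos hpos, mul_pos (mul_pos hpos hpos) (sub_pos.2 hn)]

theorem planarForm_iterate_lt {v : Fin 2 → ℝ} (hv : v ≠ 0)
    (hn : planarForm 1 v < (1 / 100) ^ 2) :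
    planarForm 1 ((spiral (-1) ∘ twist (-1))^[2] v) < planarForm 1 v := by
  have hpos := planarForm_pos one_pos hv
  have h := (abs_le.1 (abs_planarForm_iterate_sub_le (σ := -1) (v := v) (by simp) (by linarith))).2
  nlinarith [mul_pos hpos hpos, mul_pos (mul_pos hpos hpos) (sub_pos.2 hn)]

end Planar

/-- for every `m ≥ 1` there are two polynomial maps of `ℝ^{2m}` fixing `0`,
LAS for both but with `0` a repeller for the composition `f₂ ∘ f₁`; and also two
polynomial maps fixing `0`, repeller for both but with `0` LAS for the composition. -/
theorem stmt7 (m : ℕ) (hm : 1 ≤ m) :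
    (∃ f₁ f₂ : EuclideanSpace ℝ (Fin (2 * m)) → EuclideanSpace ℝ (Fin (2 * m)),
      IsPolyMap f₁ ∧ IsPolyMap f₂ ∧ f₁ 0 = 0 ∧ f₂ 0 = 0 ∧
      IsLAS f₁ 0 ∧ IsLAS f₂ 0 ∧ IsRepeller (f₂ ∘ f₁) 0) ∧
    (∃ g₁ g₂ : EuclideanSpace ℝ (Fin (2 * m)) → EuclideanSpace ℝ (Fin (2 * m)),
      IsPolyMap g₁ ∧ IsPolyMap g₂ ∧ g₁ 0 = 0 ∧ g₂ 0 = 0 ∧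
      IsRepeller g₁ 0 ∧ IsRepeller g₂ 0 ∧ IsLAS (g₂ ∘ g₁) 0) := by
  have hc : ∀ σ, Continuous (spiral σ ∘ twist σ) := fun σ =>
    (continuous_spiral σ).comp (continuous_twist σ)
  have hz : ∀ σ, (spiral σ ∘ twist σ) 0 = 0 := fun σ => by simp [twist_zero, spiral_zero]
  refine ⟨⟨blockMap m (twist 1), blockMap m (spiral 1), isPolyMap_twist m 1, isPolyMap_spiral m 1,
      blockMap_zero (twist_zero 1), blockMap_zero (spiral_zero 1), ?_, ?_, ?_⟩,
    ⟨blockMap m (twist (-1)), blockMap m (spiral (-1)), isPolyMap_twist m (-1),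
      isPolyMap_spiral m (-1), blockMap_zero (twist_zero (-1)), blockMap_zero (spiral_zero (-1)),
      ?_, ?_, ?_⟩⟩
  · exact isLAS_blockMap (continuous_twist 1) (twist_zero 1) (k := 1 / 2) (ρ := 1) (by norm_num)
      (by norm_num) one_pos fun v hv h => planarForm_twist_lt hv (by simpa using h)
  · exact isLAS_blockMap (continuous_spiral 1) (spiral_zero 1) (k := 1) (ρ := 1) one_pos
      le_rfl one_pos fun v hv h => planarForm_spiral_lt hv (by simpa using h)
  · rw [blockMap_comp]
    refine IsRepeller.of_iterate (j := 2) ?_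
    rw [iterate_blockMap]
    exact isRepeller_blockMap ((hc 1).iterate 2) (Function.iterate_fixed (hz 1) 2) one_pos le_rfl
      (by norm_num) fun v hv h => lt_planarForm_iterate hv h
  · exact isRepeller_blockMap (continuous_twist (-1)) (twist_zero (-1)) (k := 1 / 2) (ρ := 1)
      (by norm_num) (by norm_num) one_pos fun v hv _ => lt_planarForm_twist hv
  · exact isRepeller_blockMap (continuous_spiral (-1)) (spiral_zero (-1)) (k := 1) (ρ := 1)
      one_pos le_rfl one_pos fun v hv _ => lt_planarForm_spiral hv
  · rw [blockMap_comp]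
    refine IsLAS.of_iterate_two (continuous_blockMap (hc (-1))) (blockMap_zero (hz (-1))) ?_
    rw [iterate_blockMap]
    exact isLAS_blockMap ((hc (-1)).iterate 2) (Function.iterate_fixed (hz (-1)) 2) one_pos le_rfl
      (by norm_num) fun v hv h => planarForm_iterate_lt hv h
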